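/- For every k ≥ 1 and every collection of k-cylinders {S_i : i ∈ I} with I ⊆ {0,1,2}^k, one has μ(⋃_{i∈I} S_i) ≤ μ_k(⋃_{i∈I} S_i). -/

import Mathlib

open MeasureTheory Metric Set
open scoped ENNReal

noncomputable section

/-- The point `(a, b)` of the Euclidean plane. -/
def pt (a b : ℝ) : EuclideanSpace ℝ (Fin 2) := (WithLp.equiv 2 (Fin 2 → ℝ)).symm ![a, b]

/-- The translation vectors of the three similitudes. -/
def v : Fin 3 → EuclideanSpace ℝ (Fin 2)
  | 0 => pt 0 0
  | 1 => pt (1/2) 0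
  | 2 => pt (1/4) (Real.sqrt 3 / 4)

/-- The three similitudes generating the Sierpinski gasket. -/
def f (i : Fin 3) (x : EuclideanSpace ℝ (Fin 2)) : EuclideanSpace ℝ (Fin 2) :=
  (1/2 : ℝ) • x + v i

/-- `fword [i₁, …, i_k] = f_{i₁} ∘ ⋯ ∘ f_{i_k}`. -/
def fword : List (Fin 3) → EuclideanSpace ℝ (Fin 2) → EuclideanSpace ℝ (Fin 2)
  | [] => id
  | i :: l => f i ∘ fword l

/-- The similarity dimension `s = log 3 / log 2`. -/
def sDim : ℝ := Real.log 3 / Real.log 2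

/-- The normalised Hausdorff measure `μ = H^s(S)⁻¹ • H^s⌊S`. -/
def muS (S : Set (EuclideanSpace ℝ (Fin 2))) : Measure (EuclideanSpace ℝ (Fin 2)) :=
  (μH[sDim] S)⁻¹ • (μH[sDim]).restrict S

/-- Fixed points `z_i = 2 v_i`. -/
def z (i : Fin 3) : EuclideanSpace ℝ (Fin 2) := (2 : ℝ) • v i

/-- The Hutchinson operator. -/
def Fop (A : Set (EuclideanSpace ℝ (Fin 2))) : Set (EuclideanSpace ℝ (Fin 2)) :=
  f 0 '' A ∪ f 1 '' A ∪ f 2 '' A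

/-- The discrete approximations `A_k = F^{k-1}(A₁)`, `A₁ = {z₀, z₁, z₂}`. -/
def Aset (k : ℕ) : Set (EuclideanSpace ℝ (Fin 2)) := Fop^[k - 1] {z 0, z 1, z 2}

/-- The discrete measures `μ_k`. -/
def muk (k : ℕ) : Measure (EuclideanSpace ℝ (Fin 2)) :=
  ((3 : ℝ≥0∞)⁻¹ ^ k) • ∑ i : Fin (k - 1) → Fin 3,
    (Measure.dirac (fword (List.ofFn i) (z 0)) + Measure.dirac (fword (List.ofFn i) (z 1)) +
      Measure.dirac (fword (List.ofFn i) (z 2)))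

/-- The centred Hausdorff premeasure `C₀^s(A)` (the limit as `δ → 0⁺` is written as a
supremum over `δ > 0`, the inner infimum being antitone in `δ`). -/
def centredPremeasure (s : ℝ) (A : Set (EuclideanSpace ℝ (Fin 2))) : ℝ≥0∞ :=
  ⨆ (δ : ℝ) (_ : 0 < δ),
    ⨅ (x : ℕ → EuclideanSpace ℝ (Fin 2)) (d : ℕ → ℝ) (_ : ∀ n, x n ∈ A)
      (_ : ∀ n, 0 ≤ d n) (_ : ∀ n, 2 * d n ≤ δ) (_ : A ⊆ ⋃ n, closedBall (x n) (d n)),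
      ∑' n, ENNReal.ofReal ((2 * d n) ^ s)

/-- The reflection across the vertical line `x₁ = 1/2`. -/
def refl2 (x : EuclideanSpace ℝ (Fin 2)) : EuclideanSpace ℝ (Fin 2) := pt (1 - x 0) (x 1)

/-- The reflection across the vertical line `x₁ = 1/4`. -/
def refl4 (x : EuclideanSpace ℝ (Fin 2)) : EuclideanSpace ℝ (Fin 2) := pt (1/2 - x 0) (x 1)

theorem f_z (i : Fin 3) : f i (z i) = z i := by
  simp only [f, z, smul_smul]
  norm_num [two_smul]

theorem lipschitzWith_f (i : Fin 3) : LipschitzWith (1 / 2) (f i) := by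
  refine LipschitzWith.of_dist_le_mul fun x y => ?_
  simp [f, dist_eq_norm, ← smul_sub, norm_smul]

theorem lipschitzWith_fword (l : List (Fin 3)) : LipschitzWith ((1 / 2) ^ l.length) (fword l) := by
  induction l with
  | nil => simpa [fword] using LipschitzWith.id
  | cons i l ih =>
    rw [List.length_cons, pow_succ']
    exact (lipschitzWith_f i).comp ih

theorem fword_append_singleton (l : List (Fin 3)) (a : Fin 3) (x : EuclideanSpace ℝ (Fin 2)) :
    fword (l ++ [a]) x = fword l (f a x) := by
  induction l with
  | nil => rfl
  | cons i l ih => simp [fword, ih]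

theorem fword_ofFn_z {n : ℕ} (i : Fin (n + 1) → Fin 3) :
    fword (List.ofFn i) (z (i (Fin.last n))) =
      fword (List.ofFn (Fin.init i)) (z (i (Fin.last n))) := by
  rw [List.ofFn_succ', List.concat_eq_append, fword_append_singleton, f_z]
  rfl

/-- A nonempty closed set that is mapped into itself by `f i` contains the fixed point of `f i`. -/
theorem z_mem_of_mapsTo {S : Set (EuclideanSpace ℝ (Fin 2))} (hS : IsClosed S) (hne : S.Nonempty)
    {i : Fin 3} (hf : MapsTo (f i) S S) : z i ∈ S := by
  obtain ⟨x, hx⟩ := hne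
  have hc : ContractingWith (1 / 2) (f i) := ⟨by norm_num, lipschitzWith_f i⟩
  have hlim := hc.tendsto_iterate_fixedPoint x
  rw [← hc.fixedPoint_unique (f_z i)] at hlim
  exact hS.mem_of_tendsto hlim (.of_forall fun n => hf.iterate n hx)

theorem sDim_pos : 0 < sDim := div_pos (Real.log_pos (by norm_num)) (Real.log_pos (by norm_num))

theorem half_pow_rpow_sDim (k : ℕ) :
    (((1 / 2 : NNReal) ^ k : NNReal) : ℝ≥0∞) ^ sDim = (3 : ℝ≥0∞)⁻¹ ^ k := by
  have h2 : (2 : ℝ≥0∞) ^ sDim = 3 := by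
    have h : (2 : ℝ) ^ sDim = 3 := by
      rw [Real.rpow_def_of_pos two_pos, sDim, mul_div_cancel₀ _ (Real.log_pos (by norm_num)).ne',
        Real.exp_log (by norm_num)]
    have := ENNReal.ofReal_rpow_of_pos (x := 2) two_pos (p := sDim)
    rw [h] at this
    simpa using this
  have h : ((1 / 2 : NNReal) : ℝ≥0∞) = 2⁻¹ := by simp
  rw [ENNReal.coe_pow, h, ← ENNReal.rpow_natCast, ← ENNReal.rpow_mul, mul_comm, ENNReal.rpow_mul,
    ENNReal.inv_rpow, h2, ENNReal.rpow_natCast]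

theorem muS_fword_image_le {S : Set (EuclideanSpace ℝ (Fin 2))} (hSpos : 0 < μH[sDim] S)
    (hSfin : μH[sDim] S < ⊤) (l : List (Fin 3)) :
    muS S (fword l '' S) ≤ (3 : ℝ≥0∞)⁻¹ ^ l.length := by
  calc muS S (fword l '' S)
      ≤ (μH[sDim] S)⁻¹ * μH[sDim] (fword l '' S) := by
        rw [muS, Measure.smul_apply, smul_eq_mul]
        gcongr
        exact Measure.restrict_le_self
    _ ≤ (μH[sDim] S)⁻¹ * ((3 : ℝ≥0∞)⁻¹ ^ l.length * μH[sDim] S) := by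
        gcongr
        rw [← half_pow_rpow_sDim]
        exact (lipschitzWith_fword l).lipschitzOnWith.hausdorffMeasure_image_le sDim_pos.le
    _ = (3 : ℝ≥0∞)⁻¹ ^ l.length := by
        rw [mul_left_comm, ENNReal.inv_mul_cancel hSpos.ne' hSfin.ne, mul_one]

theorem muk_succ_apply (n : ℕ) (U : Set (EuclideanSpace ℝ (Fin 2))) :
    muk (n + 1) U = (3 : ℝ≥0∞)⁻¹ ^ (n + 1) * ∑ i : Fin (n + 1) → Fin 3,
      Measure.dirac (fword (List.ofFn (Fin.init i)) (z (i (Fin.last n)))) U := by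
  rw [muk, Measure.smul_apply, smul_eq_mul, Measure.finsetSum_apply,
    ← (Fin.snocEquiv fun _ : Fin (n + 1) => Fin 3).sum_comp, Fintype.sum_prod_type_right]
  simp [Fin.snocEquiv, Fin.sum_univ_three]

theorem statement9 (S : Set (EuclideanSpace ℝ (Fin 2))) (hScomp : IsCompact S) (hSne : S.Nonempty)
    (hSinv : S = f 0 '' S ∪ f 1 '' S ∪ f 2 '' S)
    (hSpos : 0 < μH[sDim] S) (hSfin : μH[sDim] S < ⊤)
    (k : ℕ) (hk : 1 ≤ k) (I : Set (Fin k → Fin 3)) :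
    muS S (⋃ i ∈ I, fword (List.ofFn i) '' S) ≤
      muk k (⋃ i ∈ I, fword (List.ofFn i) '' S) := by
  classical
  obtain ⟨n, rfl⟩ : ∃ n, k = n + 1 := ⟨k - 1, by omega⟩
  have hmaps (i : Fin 3) : MapsTo (f i) S S := fun x hx => by
    rw [hSinv]
    fin_cases i
    · exact .inl (.inl ⟨x, hx, rfl⟩)
    · exact .inl (.inr ⟨x, hx, rfl⟩)
    · exact .inr ⟨x, hx, rfl⟩
  have hz (i : Fin 3) : z i ∈ S := z_mem_of_mapsTo hScomp.isClosed hSne (hmaps i)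
  set U := ⋃ i ∈ I, fword (List.ofFn i) '' S with hU
  calc muS S U
      = muS S (⋃ i ∈ I.toFinset, fword (List.ofFn i) '' S) := by simp [hU]
    _ ≤ ∑ i ∈ I.toFinset, muS S (fword (List.ofFn i) '' S) := measure_biUnion_finset_le _ _
    _ ≤ ∑ i ∈ I.toFinset, (3 : ℝ≥0∞)⁻¹ ^ (n + 1) := by
        gcongr with i
        simpa using muS_fword_image_le hSpos hSfin (List.ofFn i)
    _ = (3 : ℝ≥0∞)⁻¹ ^ (n + 1) * ∑ i ∈ I.toFinset, 1 := by rw [Finset.mul_sum, mul_one]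
    _ ≤ (3 : ℝ≥0∞)⁻¹ ^ (n + 1) * ∑ i ∈ I.toFinset,
          Measure.dirac (fword (List.ofFn (Fin.init i)) (z (i (Fin.last n)))) U := by
        gcongr with i hi
        rw [← fword_ofFn_z, Measure.dirac_apply_of_mem]
        exact mem_biUnion (mem_toFinset.1 hi) (mem_image_of_mem _ (hz _))
    _ ≤ muk (n + 1) U := by
        rw [muk_succ_apply]
        gcongr
        exact Finset.subset_univ _

end
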